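/- arXiv:math/0502166 — 2 statements merged into one kernel-verified Lean document; each statement's English description precedes it below -/
import Mathlib

section
/- Let α be an action of a countable abelian group G by continuous automorphisms of a compact metrizable abelian group X. Then (X, α) is expansive if and only if M = X̂ is a finitely generated ℤ[G]-module admitting a finite generating set a₁, …, a_k such that for each j, writing 𝔞_j = Ann_{ℤ[G]}(a_j), there is no ring homomorphism φ : ℤ[G]/𝔞_j → ℂ for which φ(Ḡ) is a subgroup of the unit circle (equivalently, |φ(ḡ)| = 1 for every g ∈ G). -/
/-!
Statement 0: an algebraic action of a countable abelian group `G` on a compact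
metrizable abelian group `X` is expansive iff the Pontryagin dual
`M = X̂` (realized as the group of continuous characters `X → 𝕋`) is a finitely
generated `ℤ[G]`-module admitting a finite generating set whose element
annihilators `𝔞` admit no ring homomorphism `ℤ[G]/𝔞 → ℂ` sending the image of
`G` into the unit circle (equivalently, no ring homomorphism
`Φ : ℤ[G] → ℂ` vanishing on `𝔞` with `|Φ(g)| = 1` for all `g ∈ G`).
-/

noncomputable section

/-- The circle group `𝕋 = ℝ/ℤ`. -/
abbrev Torus : Type := AddCircle (1 : ℝ)

/-- Expansiveness of a family of transformations `α i` of a topological abelian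
group `X`: there is a neighbourhood `N` of `0` with `⋂ i, α i (N) = {0}`. -/
def IsExpansive {I X : Type*} [TopologicalSpace X] [Zero X] (α : I → X → X) : Prop :=
  ∃ N ∈ nhds (0 : X), (⋂ i : I, α i '' N) = {0}

/-- The automorphism group of an additive group under composition, as in the older Mathlib
(where `AddAut A := A ≃+ A` was a multiplicative group). -/
instance AddAut.group {A : Type*} [Add A] : Group (A ≃+ A) where
  mul g h := AddEquiv.trans h g
  one := AddEquiv.refl A
  inv := AddEquiv.symm
  mul_assoc _ _ _ := rfl
  one_mul _ := rfl
  mul_one _ := rfl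
  inv_mul_cancel := AddEquiv.self_trans_symm

/-- The `ℤ[G]`-module action of `f = Σ c_g g ∈ ℤ[G]` on a (continuous) character
`a` of `X`, dual to the action `α` of `G` on `X`:  `f • a = Σ_g c_g (a ∘ α_g)`. -/
def dualSmul {G : Type} [CommGroup G] {X : Type} [AddCommGroup X] [TopologicalSpace X]
    (α : G →* (X ≃+ X)) (hc : ∀ g : G, Continuous (α g))
    (f : MonoidAlgebra ℤ G) (a : ContinuousAddMonoidHom X Torus) :
    ContinuousAddMonoidHom X Torus :=
  Finsupp.sum f.coeff fun g c => c • (a.comp ⟨(α g).toAddMonoidHom, hc g⟩)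

section Helpers

open Filter Topology MeasureTheory
open scoped ENNReal NNReal TensorProduct

theorem exists_algHom_apply_ne_zero {A : Type*} [NormedCommRing A] [NormedAlgebra ℂ A]
    [CompleteSpace A] (T : A) {c k : ℝ} (hc : 0 < c) (hk : 0 < k)
    (h : ∀ n : ℕ, k * c ^ n ≤ ‖T ^ n‖) : ∃ φ : A →ₐ[ℂ] ℂ, φ T ≠ 0 := by
  have : Nontrivial A := by
    by_contra hA
    rw [not_nontrivial_iff_subsingleton] at hA
    have := h 0
    rw [Subsingleton.elim (T ^ 0) 0, norm_zero] at this
    simp at this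
    linarith
  by_contra! hφ
  have hs : spectralRadius ℂ T = 0 := by
    refine le_antisymm (iSup₂_le fun z hz => ?_) bot_le
    obtain ⟨φ, hφz⟩ := WeakDual.CharacterSpace.mem_spectrum_iff_exists.1 hz
    have h0 := hφ (WeakDual.CharacterSpace.toAlgHom φ)
    have : φ T = 0 := h0
    rw [← hφz, this]; simp
  have ht := spectrum.pow_norm_pow_one_div_tendsto_nhds_spectralRadius T
  rw [hs] at ht
  have h2 : Tendsto (fun n : ℕ => ENNReal.ofReal (k ^ (1 / n : ℝ) * c)) atTop
      (𝓝 (ENNReal.ofReal (k ^ (0 : ℝ) * c))) := by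
    refine (ENNReal.continuous_ofReal.tendsto _).comp ?_
    refine Tendsto.mul_const _ ?_
    exact ((Real.continuousAt_const_rpow hk.ne').tendsto).comp tendsto_one_div_atTop_nhds_zero_nat
  have h3 := le_of_tendsto_of_tendsto h2 ht ?_
  · simp at h3; linarith
  · filter_upwards [eventually_gt_atTop 0] with n hn
    apply ENNReal.ofReal_le_ofReal
    have hn' : (n : ℝ) ≠ 0 := by positivity
    calc k ^ (1 / n : ℝ) * c = (k * c ^ n) ^ (1 / n : ℝ) := by
          rw [Real.mul_rpow hk.le (by positivity), ← Real.rpow_natCast, ← Real.rpow_mul hc.le]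
          field_simp; simp
      _ ≤ _ := Real.rpow_le_rpow (by positivity) (h n) (by positivity)

theorem exists_algHom_eq_zero_of_ne_top {A : Type*} [NormedCommRing A] [NormedAlgebra ℂ A]
    [CompleteSpace A] {I : Ideal A} (hI : I ≠ ⊤) :
    ∃ φ : A →ₐ[ℂ] ℂ, ∀ a ∈ I, φ a = 0 := by
  obtain ⟨m, hm, hIm⟩ := Ideal.exists_le_maximal I hI
  refine ⟨WeakDual.CharacterSpace.toAlgHom (Ideal.toCharacterSpace m), fun a ha => ?_⟩
  exact Ideal.toCharacterSpace_apply_eq_zero_of_mem m (hIm ha)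

/-- The bicommutant of a commuting set `S` in a normed algebra, as a commutative normed ring. -/
abbrev bicommutantNormedCommRing {B : Type*} [NormedRing B] [NormedAlgebra ℂ B] (S : Set B)
    (hS : S ⊆ Set.centralizer S) :
    NormedCommRing (Subalgebra.centralizer ℂ (S.centralizer)) :=
  { (inferInstance : NormedRing (Subalgebra.centralizer ℂ (S.centralizer))) with
    mul_comm := fun a b => Subtype.ext
      (b.2 a.1 (Set.centralizer_subset hS a.2)) }

theorem bicommutant_completeSpace {B : Type*} [NormedRing B] [NormedAlgebra ℂ B] [CompleteSpace B]
    (S : Set B) : CompleteSpace (Subalgebra.centralizer ℂ (S.centralizer)) :=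
  (Set.isClosed_centralizer (S.centralizer)).completeSpace_coe

theorem exists_bicommutant_algHom_apply_ne_zero {B : Type*} [NormedRing B] [NormedAlgebra ℂ B]
    [CompleteSpace B] (S : Set B) (hS : S ⊆ Set.centralizer S)
    (T : Subalgebra.centralizer ℂ (S.centralizer)) {c k : ℝ} (hc : 0 < c) (hk : 0 < k)
    (h : ∀ n : ℕ, k * c ^ n ≤ ‖(T : B) ^ n‖) :
    ∃ φ : Subalgebra.centralizer ℂ (S.centralizer) →ₐ[ℂ] ℂ, φ T ≠ 0 := by
  let := bicommutantNormedCommRing S hS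
  have := bicommutant_completeSpace S
  exact exists_algHom_apply_ne_zero T hc hk h

theorem norm_bicommutant_algHom_le {B : Type*} [NormedRing B] [NormedAlgebra ℂ B] [NormOneClass B]
    [CompleteSpace B] (S : Set B)
    (φ : Subalgebra.centralizer ℂ (S.centralizer) →ₐ[ℂ] ℂ) (a) : ‖φ a‖ ≤ ‖(a : B)‖ := by
  have := bicommutant_completeSpace S
  have : NormOneClass (Subalgebra.centralizer ℂ (S.centralizer)) := ⟨norm_one (α := B)⟩
  exact AlgHom.norm_apply_le_self φ a

theorem exists_bicommutant_algHom_eq_zero {B : Type*} [NormedRing B] [NormedAlgebra ℂ B]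
    [CompleteSpace B] (S : Set B) (hS : S ⊆ Set.centralizer S)
    (I : Ideal (Subalgebra.centralizer ℂ (S.centralizer))) (hI : I ≠ ⊤) :
    ∃ φ : Subalgebra.centralizer ℂ (S.centralizer) →ₐ[ℂ] ℂ, ∀ a ∈ I, φ a = 0 := by
  let := bicommutantNormedCommRing S hS
  have := bicommutant_completeSpace S
  exact exists_algHom_eq_zero_of_ne_top hI

theorem exists_pow_le_norm_pow_of_symmetric {E H : Type*} [NormedAddCommGroup E] [NormedSpace ℂ E]
    [NormedAddCommGroup H] [InnerProductSpace ℂ H] (ι : E →L[ℂ] H) (T : E →L[ℂ] E)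
    (hT : ∀ u v, inner ℂ (ι (T u)) (ι v) = inner ℂ (ι u) (ι (T v))) {u₀ : E}
    (hu₀ : ι (T u₀) ≠ 0) :
    ∃ c k : ℝ, 0 < c ∧ 0 < k ∧ ∀ n : ℕ, k * c ^ n ≤ ‖T ^ n‖ := by
  set b : ℕ → ℝ := fun n => ‖ι ((T ^ n) u₀)‖ with hb
  have hb1 : 0 < b 1 := by simpa [hb] using hu₀
  have hsq : ∀ n, b (n + 1) ^ 2 ≤ b (n + 2) * b n := by
    intro n
    have h1 : ((T ^ (n + 1)) u₀) = T ((T ^ n) u₀) := by rw [pow_succ']; rfl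
    have h2 : ((T ^ (n + 2)) u₀) = T ((T ^ (n + 1)) u₀) := by rw [pow_succ']; rfl
    have h3 : inner ℂ (ι ((T ^ (n + 1)) u₀)) (ι ((T ^ (n + 1)) u₀))
        = inner ℂ (ι ((T ^ (n + 2)) u₀)) (ι ((T ^ n) u₀)) := by
      rw [h2, hT, ← h1]
    have h4 := norm_inner_le_norm (𝕜 := ℂ) (ι ((T ^ (n + 2)) u₀)) (ι ((T ^ n) u₀))
    rw [← h3, inner_self_eq_norm_sq_to_K] at h4
    simpa [hb] using h4
  have hb0 : 0 < b 0 := by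
    refine lt_of_le_of_ne (norm_nonneg _) fun h => ?_
    have := hsq 0
    rw [← h] at this
    nlinarith
  set c := b 1 / b 0 with hc
  have hcpos : 0 < c := div_pos hb1 hb0
  have hstep : ∀ n, 0 < b n ∧ c * b n ≤ b (n + 1) := by
    intro n
    induction n with
    | zero => exact ⟨hb0, by rw [hc]; field_simp; simp⟩
    | succ n ih =>
      obtain ⟨h0, h1⟩ := ih
      have h2 : 0 < b (n + 1) := lt_of_lt_of_le (by positivity) h1
      refine ⟨h2, ?_⟩
      have h3 := hsq n
      have : c * b (n + 1) * b n ≤ b (n + 2) * b n := by nlinarith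
      exact le_of_mul_le_mul_right this h0
  have hgeom : ∀ n, b 0 * c ^ n ≤ b n := by
    intro n
    induction n with
    | zero => simp
    | succ n ih =>
      calc b 0 * c ^ (n + 1) = c * (b 0 * c ^ n) := by ring
        _ ≤ c * b n := by gcongr
        _ ≤ _ := (hstep n).2
  have hK : 0 < ‖ι‖ * ‖u₀‖ + 1 := by positivity
  refine ⟨c, b 0 / (‖ι‖ * ‖u₀‖ + 1), hcpos, by positivity, fun n => ?_⟩
  have h1 : b n ≤ ‖T ^ n‖ * (‖ι‖ * ‖u₀‖ + 1) := by
    calc b n ≤ ‖ι‖ * (‖T ^ n‖ * ‖u₀‖) := (ι.le_opNorm _).trans (by gcongr; exact (T ^ n).le_opNorm _)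
      _ ≤ _ := by nlinarith [norm_nonneg (T ^ n)]
  rw [div_mul_eq_mul_div, div_le_iff₀ hK]
  exact (hgeom n).trans h1

section Convolution

variable {X : Type*} [AddCommGroup X] [TopologicalSpace X] [IsTopologicalAddGroup X]

/-- The kernel of the adjoint convolution operator. -/
def adjKernel (f : C(X, ℂ)) : C(X, ℂ) := star (f.comp ⟨Neg.neg, continuous_neg⟩)

@[simp]
theorem adjKernel_apply (f : C(X, ℂ)) (x : X) : adjKernel f x = star (f (-x)) := rfl

theorem adjKernel_adjKernel (f : C(X, ℂ)) : adjKernel (adjKernel f) = f := by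
  ext x; simp

variable [CompactSpace X]

/-- Translation of continuous functions, `u ↦ u (· + y)`. -/
def translation (y : X) : C(X, ℂ) →L[ℂ] C(X, ℂ) :=
  LinearMap.mkContinuous
    { toFun := fun u => u.comp ⟨fun x => x + y, by fun_prop⟩
      map_add' := fun _ _ => rfl
      map_smul' := fun _ _ => rfl } 1 (fun u => by
      rw [one_mul, ContinuousMap.norm_le _ (norm_nonneg _)]
      exact fun x => u.norm_coe_le_norm _)

@[simp]
theorem translation_apply (y : X) (u : C(X, ℂ)) (x : X) : translation y u x = u (x + y) := rfl

theorem norm_translation_le (y : X) : ‖translation y‖ ≤ 1 :=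
  LinearMap.mkContinuous_norm_le _ zero_le_one _

theorem translation_add (y z : X) : translation (y + z) = translation y * translation z := by
  ext u x
  simp [add_assoc]

@[simp]
theorem translation_zero : translation (0 : X) = 1 := by
  ext u x
  simp

theorem continuous_translation_apply (u : C(X, ℂ)) : Continuous fun y => translation y u := by
  refine ContinuousMap.continuous_of_continuous_uncurry _ ?_
  simp only [Function.uncurry_def, translation_apply]
  fun_prop

variable [MeasurableSpace X] [BorelSpace X]

theorem integrable_smul_translation (μ : Measure X) [IsFiniteMeasureOnCompacts μ] (f u : C(X, ℂ)) :
    Integrable (fun y => f y • translation y u) μ :=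
  (f.continuous.smul (continuous_translation_apply u)).integrable_of_hasCompactSupport
    (HasCompactSupport.of_compactSpace _)

/-- Convolution operator with kernel `f`: `u ↦ ∫ f(y) u(· + y) dμ(y)`. -/
def convOp (μ : Measure X) [IsFiniteMeasure μ] :
    C(X, ℂ) →L[ℂ] C(X, ℂ) →L[ℂ] C(X, ℂ) :=
  LinearMap.mkContinuous₂
    (LinearMap.mk₂ ℂ (fun f u : C(X, ℂ) => ∫ y, f y • translation y u ∂μ)
      (fun f g u => by
        simp only [ContinuousMap.add_apply, add_smul]
        exact integral_add (integrable_smul_translation μ f u) (integrable_smul_translation μ g u))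
      (fun c f u => by
        simp only [ContinuousMap.smul_apply, smul_assoc]
        exact integral_smul c _)
      (fun f u v => by
        simp only [map_add, smul_add]
        exact integral_add (integrable_smul_translation μ f u) (integrable_smul_translation μ f v))
      (fun c f u => by
        simp only [map_smul, smul_comm _ c]
        exact integral_smul c _)) (μ.real Set.univ) (fun f u => by
    have h := norm_integral_le_of_norm_le_const (μ := μ) (C := ‖f‖ * ‖u‖)
      (f := fun y => f y • translation y u) (Eventually.of_forall fun y => by
        rw [norm_smul]
        gcongr
        · exact f.norm_coe_le_norm y
        · simpa using (translation y).le_of_opNorm_le (norm_translation_le y) u)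
    calc _ ≤ _ := h
      _ = _ := by ring)

theorem convOp_apply (μ : Measure X) [IsFiniteMeasure μ] (f u : C(X, ℂ)) :
    convOp μ f u = ∫ y, f y • translation y u ∂μ := rfl

theorem comp_convOp (μ : Measure X) [IsFiniteMeasure μ] (f : C(X, ℂ)) (B : C(X, ℂ) →L[ℂ] C(X, ℂ))
    (hB : ∀ y, B * translation y = translation y * B) : B * convOp μ f = convOp μ f * B := by
  refine ContinuousLinearMap.ext fun u => ?_
  simp only [mul_apply_eq_comp, convOp_apply]
  rw [← ContinuousLinearMap.integral_comp_comm _ (integrable_smul_translation μ f u)]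
  refine integral_congr_ae (Eventually.of_forall fun y => ?_)
  simp only [map_smul]
  exact congrArg (f y • ·) (DFunLike.congr_fun (hB y) u)

theorem translation_mul_convOp (μ : Measure X) [IsFiniteMeasure μ] [μ.IsAddRightInvariant]
    (f : C(X, ℂ)) (z : X) : translation z * convOp μ f = convOp μ (translation (-z) f) := by
  refine ContinuousLinearMap.ext fun u => ?_
  simp only [mul_apply_eq_comp, convOp_apply]
  rw [← ContinuousLinearMap.integral_comp_comm _ (integrable_smul_translation μ f u),
    ← integral_add_right_eq_self (fun y => (translation (-z) f) y • translation y u) z]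
  refine integral_congr_ae (Eventually.of_forall fun y => ?_)
  simp only [map_smul, translation_apply, add_neg_cancel_right]
  rw [add_comm y z, translation_add]
  rfl

theorem inner_translation (μ : Measure X) [IsFiniteMeasure μ] [μ.IsAddRightInvariant] (y : X)
    (u v : C(X, ℂ)) :
    inner ℂ (ContinuousMap.toLp 2 μ ℂ (translation y u)) (ContinuousMap.toLp 2 μ ℂ v) =
      inner ℂ (ContinuousMap.toLp 2 μ ℂ u) (ContinuousMap.toLp 2 μ ℂ (translation (-y) v)) := by
  simp only [ContinuousMap.inner_toLp, translation_apply]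
  rw [← integral_add_right_eq_self (fun x => v (x + -y) * (starRingEnd ℂ) (u x)) y]
  simp only [add_neg_cancel_right]

theorem inner_convOp (μ : Measure X) [IsFiniteMeasure μ] [μ.IsAddRightInvariant]
    [μ.IsNegInvariant] (f u v : C(X, ℂ)) :
    inner ℂ (ContinuousMap.toLp 2 μ ℂ (convOp μ f u)) (ContinuousMap.toLp 2 μ ℂ v) =
      inner ℂ (ContinuousMap.toLp 2 μ ℂ u) (ContinuousMap.toLp 2 μ ℂ (convOp μ (adjKernel f) v)) := by
  have hsmul_int : ∀ f u : C(X, ℂ), Integrable (fun y =>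
      ContinuousMap.toLp (E := ℂ) 2 μ ℂ (f y • translation y u)) μ := fun f u =>
    ContinuousLinearMap.integrable_comp _ (integrable_smul_translation μ f u)
  have h1 : ∀ f u : C(X, ℂ), ContinuousMap.toLp (E := ℂ) 2 μ ℂ (convOp μ f u) =
      ∫ y, ContinuousMap.toLp (E := ℂ) 2 μ ℂ (f y • translation y u) ∂μ := fun f u => by
    rw [convOp_apply, ContinuousLinearMap.integral_comp_comm _ (integrable_smul_translation μ f u)]
  rw [h1, h1, ← inner_conj_symm, ← integral_inner (hsmul_int _ _), ← integral_conj,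
    ← integral_inner (hsmul_int _ _), ← integral_neg_eq_self]
  refine integral_congr_ae (Eventually.of_forall fun y => ?_)
  simp only [map_smul, inner_smul_right, map_mul, inner_conj_symm, adjKernel_apply,
    inner_translation, neg_neg]
  rfl

theorem toLp_convOp_adjKernel_ne_zero (μ : Measure X) [IsFiniteMeasure μ] [μ.IsAddRightInvariant]
    [μ.IsNegInvariant] [μ.IsOpenPosMeasure] {f : C(X, ℂ)} (hf : f ≠ 0) :
    ∃ u : C(X, ℂ), ContinuousMap.toLp (E := ℂ) 2 μ ℂ
      ((convOp μ f * convOp μ (adjKernel f)) u) ≠ 0 := by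
  set u : C(X, ℂ) := star (adjKernel f) with hu
  refine ⟨u, fun h => ?_⟩
  have h1 : convOp μ (adjKernel f) u = 0 := by
    have h2 := inner_convOp μ f (convOp μ (adjKernel f) u) u
    rw [mul_apply_eq_comp] at h
    rw [h, inner_zero_left, eq_comm, inner_self_eq_zero] at h2
    exact ContinuousMap.toLp_injective μ (h2.trans (map_zero _).symm)
  have h2 : ∫ y, ‖f (-y)‖ ^ 2 ∂μ = 0 := by
    have h3 := DFunLike.congr_fun h1 (0 : X)
    rw [convOp_apply, ContinuousMap.integral_apply (integrable_smul_translation μ _ u)] at h3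
    have h4 : ∀ y, ((adjKernel f) y • translation y u) 0 = ((‖f (-y)‖ ^ 2 : ℝ) : ℂ) := by
      intro y
      simp [hu, Complex.conj_mul']
    simp only [h4, ContinuousMap.zero_apply] at h3
    exact_mod_cast h3
  have hcont : Continuous fun y : X => ‖f (-y)‖ ^ 2 := by fun_prop
  obtain ⟨x, hx⟩ := DFunLike.ne_iff.1 hf
  have := hcont.integral_pos_of_hasCompactSupport_nonneg_nonzero (μ := μ)
    (HasCompactSupport.of_compactSpace _) (fun y => by positivity) (x := -x) (by simpa using hx)
  linarith

end Convolution

/-- A continuous homomorphism into the circle, given by a complex function of modulus one. -/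
theorem exists_torusHom_of_unitary {X : Type*} [AddCommGroup X] [TopologicalSpace X]
    (χ : X → ℂ) (hχ : Continuous χ) (hadd : ∀ x y, χ (x + y) = χ x * χ y) (hnorm : ∀ x, ‖χ x‖ = 1) :
    ∃ ψ : ContinuousAddMonoidHom X (AddCircle (1 : ℝ)),
      ∀ x, ((AddCircle.toCircle (ψ x) : Circle) : ℂ) = χ x := by
  let c : X → Circle := fun x => ⟨χ x, mem_sphere_zero_iff_norm.2 (hnorm x)⟩
  let e := AddCircle.homeomorphCircle (T := 1) one_ne_zero
  have he : ∀ x, (e.symm (c x)).toCircle = c x := fun x => by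
    rw [← AddCircle.homeomorphCircle_apply one_ne_zero]; exact e.apply_symm_apply _
  refine ⟨⟨AddMonoidHom.mk' (fun x => e.symm (c x)) fun x y => ?_, ?_⟩, fun x => ?_⟩
  · apply AddCircle.injective_toCircle one_ne_zero
    rw [AddCircle.toCircle_add, he, he, he]
    exact Circle.ext (hadd x y)
  · exact e.symm.continuous.comp (hχ.subtype_mk _)
  · exact congrArg Subtype.val (he x)

theorem exists_torusHom_ne_zero {X : Type*} [AddCommGroup X] [TopologicalSpace X]
    [IsTopologicalAddGroup X] [CompactSpace X] [T2Space X] {x₀ : X} (hx₀ : x₀ ≠ 0) :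
    ∃ ψ : ContinuousAddMonoidHom X (AddCircle (1 : ℝ)), ψ x₀ ≠ 0 := by
  borelize X
  let μ : Measure X := Measure.addHaar
  obtain ⟨f₀, hf₀⟩ : ∃ f : C(X, ℝ), f 0 ≠ f x₀ := by
    obtain ⟨f, hf0, hf1, -⟩ := exists_continuous_zero_one_of_isClosed (X := X)
      (isClosed_singleton (x := 0)) (isClosed_singleton (x := x₀))
      (Set.disjoint_singleton.2 hx₀.symm)
    refine ⟨f, ?_⟩
    rw [hf0 rfl, hf1 rfl]
    simp
  let f : C(X, ℂ) := (⟨Complex.ofReal, Complex.continuous_ofReal⟩ : C(ℝ, ℂ)).comp f₀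
  let h : C(X, ℂ) := translation (-x₀) f - f
  have hh : h ≠ 0 := by
    intro h0
    have := DFunLike.congr_fun h0 x₀
    simp only [h, f, ContinuousMap.sub_apply, translation_apply, add_neg_cancel,
      ContinuousMap.comp_apply, ContinuousMap.coe_mk, ContinuousMap.zero_apply, sub_eq_zero] at this
    exact hf₀ (by exact_mod_cast this)
  let S : Set (C(X, ℂ) →L[ℂ] C(X, ℂ)) := Set.range translation
  have hS : S ⊆ Set.centralizer S := by
    rintro _ ⟨y, rfl⟩ _ ⟨z, rfl⟩
    rw [← translation_add, ← translation_add, add_comm]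
  let A := Subalgebra.centralizer ℂ S.centralizer
  have hconv : ∀ f, convOp μ f ∈ A := fun f B hB =>
    comp_convOp μ f B fun y => (hB _ ⟨y, rfl⟩).symm
  have htr : ∀ y, translation y ∈ A := fun y => Set.subset_centralizer_centralizer ⟨y, rfl⟩
  let t : X → A := fun y => ⟨translation y, htr y⟩
  let K : C(X, ℂ) → A := fun f => ⟨convOp μ f, hconv f⟩
  have hK : Continuous K := (convOp μ).continuous.subtype_mk _
  obtain ⟨u, hu⟩ := toLp_convOp_adjKernel_ne_zero μ hh
  obtain ⟨c, k, hc, hk, hck⟩ := exists_pow_le_norm_pow_of_symmetric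
    (ContinuousMap.toLp (E := ℂ) 2 μ ℂ) (convOp μ h * convOp μ (adjKernel h)) (fun u v => by
      simp only [mul_apply_eq_comp]
      rw [inner_convOp, inner_convOp, adjKernel_adjKernel]) hu
  obtain ⟨φ, hφ⟩ := exists_bicommutant_algHom_apply_ne_zero S hS (K h * K (adjKernel h)) hc hk hck
  have hφc : Continuous φ :=
    AddMonoidHomClass.continuous_of_bound φ 1 fun a => by
      rw [one_mul]; exact norm_bicommutant_algHom_le S φ a
  have htK : ∀ y g, t y * K g = K (translation (-y) g) := fun y g =>
    Subtype.ext (translation_mul_convOp μ g y)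
  have hKh : K h = t x₀ * K f - K f := by
    rw [htK]
    exact Subtype.ext (map_sub (convOp μ) _ _)
  rw [map_mul] at hφ
  have hφh := left_ne_zero_of_mul hφ
  rw [hKh, map_sub, map_mul, ← sub_one_mul] at hφh
  have hφf := right_ne_zero_of_mul hφh
  have hφx := left_ne_zero_of_mul hφh
  have hadd : ∀ x y, φ (t (x + y)) = φ (t x) * φ (t y) := fun x y => by
    rw [← map_mul]
    exact congrArg φ (Subtype.ext (translation_add x y))
  have hle : ∀ x, ‖φ (t x)‖ ≤ 1 := fun x =>
    (norm_bicommutant_algHom_le S φ _).trans (norm_translation_le x)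
  have hzero : φ (t 0) = 1 := by
    rw [← map_one φ]
    exact congrArg φ (Subtype.ext translation_zero)
  have hnorm : ∀ x, ‖φ (t x)‖ = 1 := fun x => by
    refine le_antisymm (hle x) ?_
    have h1 : ‖φ (t x)‖ * ‖φ (t (-x))‖ = 1 := by
      rw [← norm_mul, ← hadd, add_neg_cancel, hzero, norm_one]
    nlinarith [hle (-x), norm_nonneg (φ (t x))]
  have hcont : Continuous fun x => φ (t x) := by
    have h1 : (fun x => φ (t x)) = fun x => φ (K (translation (-x) f)) / φ (K f) := by
      ext x
      rw [← htK, map_mul, mul_div_cancel_right₀ _ hφf]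
    rw [h1]
    exact (hφc.comp (hK.comp ((continuous_translation_apply f).comp continuous_neg))).div_const _
  obtain ⟨ψ, hψ⟩ := exists_torusHom_of_unitary _ hcont hadd hnorm
  refine ⟨ψ, fun h0 => hφx ?_⟩
  rw [← hψ, h0]
  simp

/-- The multiplicative homomorphism sending a character to the associated unitary function. -/
def unitaryFun (X : Type*) [AddCommGroup X] [TopologicalSpace X] :
    Multiplicative (ContinuousAddMonoidHom X (AddCircle (1 : ℝ))) →* C(X, ℂ) where
  toFun γ := ⟨fun x => (AddCircle.toCircle (γ.toAdd x) : Circle),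
    continuous_subtype_val.comp (AddCircle.continuous_toCircle.comp (map_continuous γ.toAdd))⟩
  map_one' := by ext x; simp
  map_mul' γ δ := by ext x; simp [AddCircle.toCircle_add]

theorem unitaryFun_apply {X : Type*} [AddCommGroup X] [TopologicalSpace X]
    (γ : Multiplicative (ContinuousAddMonoidHom X (AddCircle (1 : ℝ)))) (x : X) :
    unitaryFun X γ x = (AddCircle.toCircle (γ.toAdd x) : Circle) := rfl

theorem star_unitaryFun {X : Type*} [AddCommGroup X] [TopologicalSpace X]
    (γ : Multiplicative (ContinuousAddMonoidHom X (AddCircle (1 : ℝ)))) :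
    star (unitaryFun X γ) = unitaryFun X γ⁻¹ := by
  ext x
  have h : γ⁻¹.toAdd x = -γ.toAdd x := rfl
  rw [unitaryFun_apply, h, AddCircle.toCircle_neg, Circle.coe_inv_eq_conj]
  rfl

theorem integral_unitaryFun_eq_zero {X : Type*} [AddCommGroup X] [TopologicalSpace X]
    [IsTopologicalAddGroup X] [MeasurableSpace X] [BorelSpace X] (μ : Measure X)
    [μ.IsAddRightInvariant] {γ : Multiplicative (ContinuousAddMonoidHom X (AddCircle (1 : ℝ)))}
    (hγ : γ ≠ 1) : ∫ x, unitaryFun X γ x ∂μ = 0 := by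
  obtain ⟨y, hy⟩ : ∃ y, γ.toAdd y ≠ 0 :=
    DFunLike.ne_iff.1 (show γ.toAdd ≠ 0 from hγ)
  have hy1 : unitaryFun X γ y ≠ 1 := by
    intro h
    rw [unitaryFun_apply, ← Circle.coe_one, ← AddCircle.toCircle_zero (T := 1)] at h
    exact hy (AddCircle.injective_toCircle one_ne_zero (Circle.ext h))
  have h := integral_add_right_eq_self (μ := μ) (unitaryFun X γ) y
  have h2 : ∀ x, unitaryFun X γ (x + y) = unitaryFun X γ x * unitaryFun X γ y := fun x => by
    simp [unitaryFun_apply, AddCircle.toCircle_add]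
  simp only [h2, integral_mul_const] at h
  by_contra h0
  exact hy1 ((mul_eq_left₀ h0).1 h)

/-- A subgroup of characters of a compact group which separates points is the whole dual. -/
theorem mem_of_separating {X : Type*} [AddCommGroup X] [TopologicalSpace X]
    [IsTopologicalAddGroup X] [CompactSpace X]
    (Γ : AddSubgroup (ContinuousAddMonoidHom X (AddCircle (1 : ℝ))))
    (hΓ : ∀ x, (∀ γ ∈ Γ, γ x = 0) → x = 0) (ψ : ContinuousAddMonoidHom X (AddCircle (1 : ℝ))) :
    ψ ∈ Γ := by
  by_contra hψ
  borelize X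
  let μ : Measure X := Measure.addHaar
  let M : Submonoid C(X, ℂ) := (AddSubgroup.toSubgroup Γ).toSubmonoid.map (unitaryFun X)
  let A : StarSubalgebra ℂ C(X, ℂ) :=
    { Algebra.adjoin ℂ (M : Set C(X, ℂ)) with
      star_mem' := fun {a} ha => by
        change a ∈ Algebra.adjoin ℂ (M : Set C(X, ℂ)) at ha
        change star a ∈ Algebra.adjoin ℂ (M : Set C(X, ℂ))
        induction ha using Algebra.adjoin_induction with
        | mem x hx =>
          obtain ⟨γ, hγ, rfl⟩ := hx
          exact Algebra.subset_adjoin ⟨γ⁻¹, (AddSubgroup.toSubgroup Γ).inv_mem hγ,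
            (star_unitaryFun γ).symm⟩
        | algebraMap r => rw [← algebraMap_star_comm]; exact Subalgebra.algebraMap_mem _ _
        | add x y _ _ hx hy => rw [star_add]; exact add_mem hx hy
        | mul x y _ _ hx hy => rw [star_mul]; exact mul_mem hy hx }
  have hsep : A.SeparatesPoints := by
    intro x y hxy
    obtain ⟨γ, hγ, hne⟩ : ∃ γ ∈ Γ, γ (x - y) ≠ 0 := by
      by_contra! h
      exact hxy (sub_eq_zero.1 (hΓ _ h))
    refine ⟨_, ⟨unitaryFun X (.ofAdd γ), Algebra.subset_adjoin ⟨_, hγ, rfl⟩, rfl⟩, fun h => hne ?_⟩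
    rw [map_sub, sub_eq_zero]
    exact AddCircle.injective_toCircle one_ne_zero (Circle.ext h)
  have htop := ContinuousMap.starSubalgebra_topologicalClosure_eq_top_of_separatesPoints A hsep
  let L : C(X, ℂ) →L[ℂ] ℂ := (innerSL ℂ (ContinuousMap.toLp (E := ℂ) 2 μ ℂ
    (unitaryFun X (.ofAdd ψ)))).comp (ContinuousMap.toLp (E := ℂ) 2 μ ℂ)
  have hL : ∀ f, L f = ∫ x, f x * star (unitaryFun X (.ofAdd ψ)) x ∂μ := fun f =>
    ContinuousMap.inner_toLp μ _ _
  have hLA : ∀ f ∈ Algebra.adjoin ℂ (M : Set C(X, ℂ)), L f = 0 := by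
    intro f hf
    rw [← Subalgebra.mem_toSubmodule, Algebra.adjoin_eq_span, Submonoid.closure_eq] at hf
    induction hf using Submodule.span_induction with
    | mem x hx =>
      obtain ⟨γ, hγ, rfl⟩ := hx
      rw [hL, star_unitaryFun]
      simp only [← ContinuousMap.mul_apply, ← map_mul]
      refine integral_unitaryFun_eq_zero μ fun h => hψ ?_
      rw [mul_inv_eq_one] at h
      rw [h] at hγ
      exact hγ
    | zero => exact map_zero L
    | add x y _ _ hx hy => rw [map_add, hx, hy, add_zero]
    | smul a x _ hx => rw [map_smul, hx, smul_zero]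
  have hL0 : ∀ f, L f = 0 := by
    intro f
    have hf : f ∈ A.topologicalClosure := htop ▸ StarSubalgebra.mem_top
    exact closure_minimal (t := {f | L f = 0}) hLA
      (isClosed_eq L.continuous continuous_const) hf
  have h1 := hL0 (unitaryFun X (.ofAdd ψ))
  have h2 : (ContinuousMap.toLp (E := ℂ) 2 μ ℂ (unitaryFun X (.ofAdd ψ))) = 0 :=
    inner_self_eq_zero.1 h1
  have h3 := DFunLike.congr_fun
    (ContinuousMap.toLp_injective (E := ℂ) (𝕜 := ℂ) (p := 2) μ (h2.trans (map_zero _).symm)) 0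
  simp [unitaryFun_apply] at h3

/-- Evaluation of characters as a continuous homomorphism into a product of circles. -/
def evalChar (X : Type*) [AddCommGroup X] [TopologicalSpace X] :
    X →+ (ContinuousAddMonoidHom X (AddCircle (1 : ℝ)) → AddCircle (1 : ℝ)) where
  toFun x χ := χ x
  map_zero' := by ext χ; simp
  map_add' x y := by ext χ; simp

theorem continuous_evalChar (X : Type*) [AddCommGroup X] [TopologicalSpace X] :
    Continuous (evalChar X) := continuous_pi fun χ => map_continuous χ

theorem evalChar_injective (X : Type*) [AddCommGroup X] [TopologicalSpace X]
    [IsTopologicalAddGroup X] [CompactSpace X] [T2Space X] : Function.Injective (evalChar X) := by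
  refine (injective_iff_map_eq_zero _).2 fun x hx => ?_
  by_contra h
  obtain ⟨ψ, hψ⟩ := exists_torusHom_ne_zero h
  exact hψ (congrFun hx ψ)

/-- Surjectivity in Pontryagin duality: every homomorphism from the dual group to the circle is
the evaluation at a point. -/
theorem exists_forall_apply_eq {X : Type*} [AddCommGroup X] [TopologicalSpace X]
    [IsTopologicalAddGroup X] [CompactSpace X]
    (h : ContinuousAddMonoidHom X (AddCircle (1 : ℝ)) →+ AddCircle (1 : ℝ)) :
    ∃ x : X, ∀ χ : ContinuousAddMonoidHom X (AddCircle (1 : ℝ)), χ x = h χ := by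
  let K := (evalChar X).range
  have hK : IsClosed (K : Set (ContinuousAddMonoidHom X (AddCircle (1 : ℝ)) → AddCircle (1 : ℝ))) :=
    (isCompact_range (continuous_evalChar X)).isClosed
  suffices hmem : (h : _ → AddCircle (1 : ℝ)) ∈ K by
    obtain ⟨x, hx⟩ := hmem
    exact ⟨x, congrFun hx⟩
  by_contra hmem
  have hq : (QuotientAddGroup.mk (h : _ → AddCircle (1 : ℝ)) : _ ⧸ K) ≠ 0 := fun h0 =>
    hmem ((QuotientAddGroup.eq_zero_iff _).1 h0)
  obtain ⟨ψ, hψ⟩ := exists_torusHom_ne_zero hq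
  let Ψ : ContinuousAddMonoidHom (ContinuousAddMonoidHom X (AddCircle (1 : ℝ)) → AddCircle (1 : ℝ))
      (AddCircle (1 : ℝ)) :=
    ψ.comp ⟨QuotientAddGroup.mk' K, QuotientAddGroup.continuous_mk⟩
  let Γ : AddSubgroup (ContinuousAddMonoidHom
      (ContinuousAddMonoidHom X (AddCircle (1 : ℝ)) → AddCircle (1 : ℝ)) (AddCircle (1 : ℝ))) :=
    { carrier := {F | ∃ m, ∀ f : ContinuousAddMonoidHom X (AddCircle (1 : ℝ)) →+
        AddCircle (1 : ℝ), F f = f m}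
      zero_mem' := ⟨0, fun f => by simp⟩
      add_mem' := by
        rintro F F' ⟨m, hm⟩ ⟨m', hm'⟩
        exact ⟨m + m', fun f => by simp [hm, hm']⟩
      neg_mem' := by
        rintro F ⟨m, hm⟩
        exact ⟨-m, fun f => by rw [map_neg, ← hm]; rfl⟩ }
  obtain ⟨m, hm⟩ : Ψ ∈ Γ := by
    refine mem_of_separating Γ (fun y hy => ?_) Ψ
    ext χ
    exact hy ⟨Pi.evalAddMonoidHom _ χ, continuous_apply χ⟩ ⟨χ, fun f => rfl⟩
  have hm0 : m = 0 := by
    ext x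
    have h1 := hm ((Pi.evalAddMonoidHom _ x).comp
      { toFun := fun χ : ContinuousAddMonoidHom X (AddCircle (1 : ℝ)) => (χ : X → AddCircle (1 : ℝ))
        map_zero' := rfl
        map_add' := fun _ _ => rfl })
    have h2 : (QuotientAddGroup.mk (evalChar X x) : _ ⧸ K) = 0 :=
      (QuotientAddGroup.eq_zero_iff _).2 ⟨x, rfl⟩
    have h3 : Ψ (evalChar X x) = 0 := (congrArg ψ h2).trans (map_zero ψ)
    exact h1.symm.trans h3
  refine hψ ?_
  have := hm h
  rw [hm0, map_zero] at this
  exact this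

theorem exists_finset_norm_lt_subset {X : Type*} [AddCommGroup X] [TopologicalSpace X]
    [IsTopologicalAddGroup X] [CompactSpace X] [T2Space X] {N : Set X} (hN : N ∈ 𝓝 (0 : X)) :
    ∃ (I : Finset (ContinuousAddMonoidHom X (AddCircle (1 : ℝ)))) (ε : ℝ), 0 < ε ∧
      ∀ x, (∀ χ ∈ I, ‖χ x‖ < ε) → x ∈ N := by
  have he := ((continuous_evalChar X).isClosedEmbedding (evalChar_injective X)).isInducing
  rw [he.nhds_eq_comap, map_zero, nhds_pi] at hN
  obtain ⟨U, hU, hUN⟩ := mem_comap.1 hN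
  obtain ⟨I, t, ht, hIt⟩ := Filter.mem_pi'.1 hU
  have h1 : ∀ χ, ∃ ε > 0, Metric.ball (0 : AddCircle (1 : ℝ)) ε ⊆ t χ := fun χ =>
    Metric.mem_nhds_iff.1 (ht χ)
  choose ε hε hεt using h1
  obtain ⟨δ, hδ, hδI⟩ : ∃ δ > 0, ∀ χ ∈ I, δ ≤ ε χ := by
    have h : ∀ᶠ δ in 𝓝[>] (0 : ℝ), ∀ χ ∈ I, δ ≤ ε χ := (I.eventually_all).2 fun χ _ =>
      by
      filter_upwards [Ioc_mem_nhdsGT (hε χ)] with δ hδ using hδ.2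
    obtain ⟨δ, h1, h2⟩ := (h.and self_mem_nhdsWithin).exists
    exact ⟨δ, h2, h1⟩
  refine ⟨I, δ, hδ, fun x hx => hUN (hIt fun χ hχ => hεt χ ?_)⟩
  rw [mem_ball_zero_iff]
  exact (hx χ hχ).trans_le (hδI χ hχ)

theorem exists_semilinear_ne_zero {R M : Type*} [CommRing R] [AddCommGroup M] [Module R M]
    [Module.Finite R M] {k : Type*} [Field k] (Φ : R →+* k) {m : M}
    (hm : ∀ r : R, r • m = 0 → Φ r = 0) :
    ∃ θ : M →+ k, (∀ (r : R) (b : M), θ (r • b) = Φ r * θ b) ∧ ∃ b, θ b ≠ 0 := by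
  let p : PrimeSpectrum R := ⟨RingHom.ker Φ, RingHom.ker_isPrime Φ⟩
  have hp : p ∈ Module.support R M := Module.mem_support_iff_exists_annihilator.2
    ⟨m, fun r hr => hm r ((Submodule.mem_annihilator_span_singleton m r).1 hr)⟩
  have := (Module.mem_support_iff_nontrivial_residueField_tensorProduct p).1 hp
  have hprime : p.asIdeal.IsPrime := p.isPrime
  let κ := p.asIdeal.ResidueField
  let e : κ →+* k := Ideal.ResidueField.lift p.asIdeal Φ le_rfl fun r hr =>
    IsUnit.mk0 (Φ r) hr
  have he : ∀ r, e (algebraMap R κ r) = Φ r := Ideal.ResidueField.lift_algebraMap _ _ _ _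
  obtain ⟨v, hv⟩ := exists_ne (0 : TensorProduct R κ M)
  obtain ⟨D, hD⟩ : ∃ D : Module.Dual κ (TensorProduct R κ M), D v ≠ 0 := by
    by_contra! h
    exact hv ((Module.forall_dual_apply_eq_zero_iff κ v).1 h)
  refine ⟨e.toAddMonoidHom.comp (D.toAddMonoidHom.comp
    (TensorProduct.mk R κ M 1).toAddMonoidHom), fun r b => ?_, ?_⟩
  · have h1 : D ((1 : κ) ⊗ₜ[R] (r • b)) = algebraMap R κ r * D ((1 : κ) ⊗ₜ[R] b) := by
      rw [TensorProduct.tmul_smul, ← algebraMap_smul κ r ((1 : κ) ⊗ₜ[R] b), map_smul, smul_eq_mul]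
    have h2 := congrArg e h1
    rw [map_mul, he] at h2
    exact h2
  · by_contra! h
    have h1 : ∀ b, D ((1 : κ) ⊗ₜ[R] b) = 0 := fun b => (map_eq_zero e).1 (h b)
    refine hD ((?_ : ∀ w, D w = 0) v)
    intro w
    induction w using TensorProduct.induction_on with
    | zero => exact map_zero D
    | tmul x b =>
      rw [← mul_one x, ← smul_eq_mul, ← TensorProduct.smul_tmul', map_smul, h1, smul_zero]
    | add x y hx hy => rw [map_add, hx, hy, add_zero]

theorem exists_finset_one_mem_span {G B : Type*} [CommGroup G] [NormedRing B] [NormedAlgebra ℂ B]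
    [CompleteSpace B] [NormOneClass B] (L : G →* B) (hL : ∀ g, ‖L g‖ ≤ 1)
    (s : Set (MonoidAlgebra ℤ G))
    (hs : ¬ ∃ Φ : MonoidAlgebra ℤ G →+* ℂ, (∀ f ∈ s, Φ f = 0) ∧
      ∀ g : G, ‖Φ (MonoidAlgebra.of ℤ G g)‖ = 1) :
    ∃ T : Finset (MonoidAlgebra ℤ G), (T : Set (MonoidAlgebra ℤ G)) ⊆ s ∧
      (1 : B) ∈ Ideal.span (MonoidAlgebra.lift ℤ B G L '' T) := by
  let S : Set B := Set.range L
  have hS : S ⊆ Set.centralizer S := by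
    rintro _ ⟨g, rfl⟩ _ ⟨h, rfl⟩
    rw [← map_mul, ← map_mul, mul_comm]
  let A := Subalgebra.centralizer ℂ S.centralizer
  let L' : G →* A := L.codRestrict A fun g => Set.subset_centralizer_centralizer ⟨g, rfl⟩
  let ρ := MonoidAlgebra.lift ℤ A G L'
  have hρ : ∀ f, (ρ f : B) = MonoidAlgebra.lift ℤ B G L f := by
    intro f
    rw [MonoidAlgebra.lift_apply, MonoidAlgebra.lift_apply]
    change A.val.toAddMonoidHom _ = _
    rw [map_finsuppSum]
    simp only [map_zsmul]
    rfl
  have htop : Ideal.span (ρ '' s) = ⊤ := by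
    by_contra hI
    obtain ⟨φ, hφ⟩ := exists_bicommutant_algHom_eq_zero S hS _ hI
    refine hs ⟨(φ : A →+* ℂ).comp (ρ : MonoidAlgebra ℤ G →+* A),
      fun f hf => hφ _ (Ideal.subset_span ⟨f, hf, rfl⟩), fun g => ?_⟩
    have h1 : ∀ g, ‖φ (L' g)‖ ≤ 1 := fun g => (norm_bicommutant_algHom_le S φ _).trans (hL g)
    have h2 : ‖φ (L' g)‖ * ‖φ (L' g⁻¹)‖ = 1 := by
      rw [← norm_mul, ← map_mul, ← map_mul, mul_inv_cancel, map_one, map_one, norm_one]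
    have h3 : ρ (MonoidAlgebra.of ℤ G g) = L' g := by
      rw [MonoidAlgebra.of_apply, MonoidAlgebra.lift_single, one_smul]
    change ‖φ (ρ (MonoidAlgebra.of ℤ G g))‖ = 1
    rw [h3]
    refine le_antisymm (h1 g) ?_
    nlinarith [h1 g⁻¹, norm_nonneg (φ (L' g))]
  obtain ⟨T', hT's, hT'⟩ := Submodule.mem_span_finite_of_mem_span
    ((Ideal.eq_top_iff_one _).1 htop)
  classical
  obtain ⟨T, hTs, rfl⟩ := Finset.subset_set_image_iff.1 hT's
  refine ⟨T, hTs, ?_⟩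
  have hle : Ideal.span (ρ '' T) ≤
      (Ideal.span (MonoidAlgebra.lift ℤ B G L '' T)).comap A.val.toRingHom := by
    rw [Ideal.span_le]
    rintro _ ⟨f, hf, rfl⟩
    exact Ideal.subset_span ⟨f, hf, (hρ f).symm⟩
  rw [Finset.coe_image] at hT'
  exact hle hT'

theorem exists_finset_forall_bounded_eq_zero {G : Type*} [CommGroup G] (s : Set (MonoidAlgebra ℤ G))
    (hs : ¬ ∃ Φ : MonoidAlgebra ℤ G →+* ℂ, (∀ f ∈ s, Φ f = 0) ∧
      ∀ g : G, ‖Φ (MonoidAlgebra.of ℤ G g)‖ = 1) :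
    ∃ T : Finset (MonoidAlgebra ℤ G), (T : Set (MonoidAlgebra ℤ G)) ⊆ s ∧
      ∀ (y : G → ℂ) (C : ℝ), (∀ g, ‖y g‖ ≤ C) →
        (∀ f ∈ T, ∀ g, (f.coeff.sum fun h c => c • y (g * h)) = 0) → y = 0 := by
  let : TopologicalSpace G := ⊥
  have : DiscreteTopology G := ⟨rfl⟩
  let E := BoundedContinuousFunction G ℂ
  let L : G →* (E →L[ℂ] E) :=
    { toFun := fun h => LinearMap.mkContinuous
        { toFun := fun y => y.compContinuous ⟨fun g => g * h, continuous_of_discreteTopology⟩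
          map_add' := fun _ _ => rfl
          map_smul' := fun _ _ => rfl } 1 (fun y => by
            rw [one_mul]
            exact (BoundedContinuousFunction.norm_le (norm_nonneg _)).2
              fun g => y.norm_coe_le_norm _)
      map_one' := by ext y g; simp
      map_mul' := fun h h' => ContinuousLinearMap.ext fun y =>
        BoundedContinuousFunction.ext fun g => congrArg y (mul_assoc g h h').symm }
  have hL : ∀ h (y : E) g, L h y g = y (g * h) := fun _ _ _ => rfl
  have hLn : ∀ h, ‖L h‖ ≤ 1 := fun h =>
    ContinuousLinearMap.opNorm_le_bound _ zero_le_one fun y => by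
      rw [one_mul]
      exact (BoundedContinuousFunction.norm_le (norm_nonneg _)).2 fun g => y.norm_coe_le_norm _
  have hρ : ∀ f (y : E) g, MonoidAlgebra.lift ℤ (E →L[ℂ] E) G L f y g =
      f.coeff.sum fun h c => c • y (g * h) := by
    intro f y g
    let ev : (E →L[ℂ] E) →+ ℂ :=
      { toFun := fun a => a y g
        map_zero' := rfl
        map_add' := fun _ _ => rfl }
    change ev (MonoidAlgebra.lift ℤ (E →L[ℂ] E) G L f) = _
    rw [MonoidAlgebra.lift_apply, map_finsuppSum]
    simp only [map_zsmul]
    rfl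
  have : Nontrivial E := ⟨0, 1, fun h => zero_ne_one (DFunLike.congr_fun h (1 : G))⟩
  obtain ⟨T, hTs, hT1⟩ := exists_finset_one_mem_span (B := E →L[ℂ] E) L hLn s hs
  refine ⟨T, hTs, fun y C hC hT => ?_⟩
  let y' : E := BoundedContinuousFunction.ofNormedAddCommGroupDiscrete y C hC
  let J : Ideal (E →L[ℂ] E) :=
    { carrier := {a | a y' = 0}
      zero_mem' := rfl
      add_mem' := fun {a b} ha hb => by
        change a y' + b y' = 0
        rw [show a y' = 0 from ha, show b y' = 0 from hb, add_zero]
      smul_mem' := fun c a ha => by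
        change c (a y') = 0
        rw [show a y' = 0 from ha, map_zero] }
  have hJ : 1 ∈ J := by
    refine Ideal.span_le.2 ?_ hT1
    rintro _ ⟨f, hf, rfl⟩
    ext g
    exact (hρ f y' g).trans (hT f hf g)
  have hy' : y' = 0 := hJ
  ext g
  exact DFunLike.congr_fun hy' g

section DualModule

variable {G : Type} [CommGroup G] {X : Type} [AddCommGroup X] [TopologicalSpace X]

/-- The action of `G` on the dual group of `X` by endomorphisms. -/
def dualEnd (α : G →* (X ≃+ X)) (hc : ∀ g : G, Continuous (α g)) :
    G →* AddMonoid.End (ContinuousAddMonoidHom X Torus) where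
  toFun g :=
    { toFun := fun a => a.comp ⟨(α g).toAddMonoidHom, hc g⟩
      map_zero' := rfl
      map_add' := fun _ _ => rfl }
  map_one' := by
    refine AddMonoidHom.ext fun a => ContinuousAddMonoidHom.ext fun x => ?_
    change a (α 1 x) = a x
    rw [map_one]
    rfl
  map_mul' g h := by
    refine AddMonoidHom.ext fun a => ContinuousAddMonoidHom.ext fun x => ?_
    change a (α (g * h) x) = a (α h (α g x))
    rw [mul_comm, map_mul]
    rfl

/-- The `ℤ[G]`-module structure on the dual group of `X`. -/
abbrev dualModule (α : G →* (X ≃+ X)) (hc : ∀ g : G, Continuous (α g)) :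
    Module (MonoidAlgebra ℤ G) (ContinuousAddMonoidHom X Torus) :=
  Module.compHom (ContinuousAddMonoidHom X Torus)
    (MonoidAlgebra.lift ℤ (AddMonoid.End (ContinuousAddMonoidHom X Torus)) G
      (dualEnd α hc)).toRingHom

theorem dualSmul_eq_lift (α : G →* (X ≃+ X)) (hc : ∀ g : G, Continuous (α g))
    (f : MonoidAlgebra ℤ G) (a : ContinuousAddMonoidHom X Torus) :
    dualSmul α hc f a =
      MonoidAlgebra.lift ℤ (AddMonoid.End (ContinuousAddMonoidHom X Torus)) G
        (dualEnd α hc) f a := by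
  let ev : AddMonoid.End (ContinuousAddMonoidHom X Torus) →+ ContinuousAddMonoidHom X Torus :=
    AddMonoidHom.eval a
  change _ = ev (MonoidAlgebra.lift ℤ (AddMonoid.End (ContinuousAddMonoidHom X Torus)) G
    (dualEnd α hc) f)
  rw [MonoidAlgebra.lift_apply, map_finsuppSum]
  simp only [map_zsmul]
  rfl

theorem dualSmul_apply (α : G →* (X ≃+ X)) (hc : ∀ g : G, Continuous (α g))
    (f : MonoidAlgebra ℤ G) (a : ContinuousAddMonoidHom X Torus) (x : X) :
    dualSmul α hc f a x = f.coeff.sum fun g c => c • a (α g x) := by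
  let ev : ContinuousAddMonoidHom X Torus →+ Torus :=
    { toFun := fun χ => χ x
      map_zero' := rfl
      map_add' := fun _ _ => rfl }
  change ev (dualSmul α hc f a) = _
  rw [dualSmul, map_finsuppSum]
  simp only [map_zsmul]
  rfl

theorem dualSmul_of_apply (α : G →* (X ≃+ X)) (hc : ∀ g : G, Continuous (α g))
    (g : G) (a : ContinuousAddMonoidHom X Torus) (x : X) :
    dualSmul α hc (MonoidAlgebra.of ℤ G g) a x = a (α g x) := by
  rw [dualSmul_apply, MonoidAlgebra.of_apply, MonoidAlgebra.coeff_single,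
    Finsupp.sum_single_index, one_smul]
  exact zero_smul ℤ _

theorem exists_real_coe_eq_norm_eq (t : Torus) : ∃ r : ℝ, (r : Torus) = t ∧ |r| = ‖t‖ := by
  obtain ⟨r, rfl⟩ := QuotientAddGroup.mk_surjective t
  refine ⟨r - round r, ?_, ?_⟩
  · rw [AddCircle.coe_sub, sub_eq_self, AddCircle.coe_eq_zero_iff]
    exact ⟨round r, by simp⟩
  · exact (UnitAddCircle.norm_eq).symm

theorem exists_pos_forall_norm_lt_imp_eq_zero (α : G →* (X ≃+ X))
    (hc : ∀ g : G, Continuous (α g)) (a : ContinuousAddMonoidHom X Torus)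
    (ha : ¬ ∃ Φ : MonoidAlgebra ℤ G →+* ℂ,
      (∀ f : MonoidAlgebra ℤ G, dualSmul α hc f a = 0 → Φ f = 0) ∧
      ∀ g : G, ‖Φ (MonoidAlgebra.of ℤ G g)‖ = 1) :
    ∃ ε : ℝ, 0 < ε ∧ ∀ x, (∀ g, ‖a (α g x)‖ < ε) → ∀ g, a (α g x) = 0 := by
  obtain ⟨T, hTs, hT⟩ := exists_finset_forall_bounded_eq_zero
    {f | dualSmul α hc f a = 0} ha
  let K : ℝ := 1 + ∑ f ∈ T, f.coeff.sum fun _ c => |(c : ℝ)|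
  have hK0 : ∀ f : MonoidAlgebra ℤ G, 0 ≤ f.coeff.sum fun _ c => |(c : ℝ)| :=
    fun f => Finset.sum_nonneg fun _ _ => abs_nonneg _
  have hK : 0 < K := by
    have := Finset.sum_nonneg fun f (_ : f ∈ T) => hK0 f
    positivity
  refine ⟨K⁻¹, inv_pos.2 hK, fun x hx => ?_⟩
  choose y hy hyn using fun g => exists_real_coe_eq_norm_eq (a (α g x))
  have hy0 : (fun g => (y g : ℂ)) = 0 := by
    refine hT _ K⁻¹ (fun g => ?_) fun f hf g => ?_
    · rw [Complex.norm_real, Real.norm_eq_abs, hyn]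
      exact (hx g).le
    · have h1 : ((f.coeff.sum fun h c => c • y (g * h) : ℝ) : Torus) = 0 := by
        let co : ℝ →+ Torus := QuotientAddGroup.mk' _
        change co _ = 0
        rw [map_finsuppSum]
        simp only [map_zsmul]
        have h2 := dualSmul_apply α hc f a (α g x)
        rw [show dualSmul α hc f a = 0 from hTs hf] at h2
        refine Eq.trans ?_ h2.symm
        refine Finset.sum_congr rfl fun h _ => ?_
        change f.coeff h • ((y (g * h) : ℝ) : Torus) = f.coeff h • a (α h (α g x))
        rw [hy, mul_comm g h, map_mul]
        rfl
      obtain ⟨n, hn⟩ := AddCircle.coe_eq_zero_iff (1 : ℝ) |>.1 h1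
      have h2 : |f.coeff.sum fun h c => c • y (g * h)| < 1 := by
        calc |f.coeff.sum fun h c => c • y (g * h)|
            ≤ f.coeff.sum fun h c => |(c : ℝ)| * K⁻¹ := by
              refine (Finset.abs_sum_le_sum_abs _ _).trans (Finset.sum_le_sum fun h _ => ?_)
              beta_reduce
              rw [zsmul_eq_mul, abs_mul, hyn]
              exact mul_le_mul_of_nonneg_left (hx _).le (abs_nonneg _)
          _ = (f.coeff.sum fun h c => |(c : ℝ)|) * K⁻¹ := (Finset.sum_mul _ _ _).symm
          _ < 1 := by
              rw [← div_eq_mul_inv, div_lt_one hK]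
              have := Finset.single_le_sum (fun f (_ : f ∈ T) => hK0 f) hf
              change _ < 1 + _
              linarith
      rw [← hn, zsmul_eq_mul, mul_one] at h2
      have hn0 : n = 0 := Int.abs_lt_one_iff.1 (by exact_mod_cast h2)
      rw [hn0, zero_smul] at hn
      have h3 := congrArg Complex.ofRealHom.toAddMonoidHom hn.symm
      rw [map_finsuppSum] at h3
      simp only [map_zsmul] at h3
      simpa using h3
  intro g
  rw [← hy, Complex.ofReal_eq_zero.1 (congrFun hy0 g), AddCircle.coe_zero]

end DualModule

theorem eq_zero_of_forall_torusHom_eq_zero {X : Type*} [AddCommGroup X] [TopologicalSpace X]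
    [IsTopologicalAddGroup X] [CompactSpace X] [T2Space X] {x : X}
    (h : ∀ ψ : ContinuousAddMonoidHom X Torus, ψ x = 0) : x = 0 := by
  by_contra hx
  obtain ⟨ψ, hψ⟩ := exists_torusHom_ne_zero hx
  exact hψ (h ψ)

theorem mem_iInter_image_iff {G X : Type*} [CommGroup G] [AddCommGroup X]
    (α : G →* (X ≃+ X)) (N : Set X) (x : X) :
    x ∈ ⋂ g : G, α g '' N ↔ ∀ g, α g x ∈ N := by
  have key : ∀ g x, α g⁻¹ (α g x) = x := fun g x => by
    change (α g⁻¹ * α g) x = x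
    rw [← map_mul, inv_mul_cancel, map_one]
    rfl
  rw [Set.mem_iInter]
  constructor
  · intro h g
    obtain ⟨z, hz, hzx⟩ := h g⁻¹
    have := key g⁻¹ z
    rw [inv_inv] at this
    rw [← hzx]
    simpa only [this] using hz
  · exact fun h g => ⟨α g⁻¹ x, h g⁻¹, by simpa only [inv_inv] using key g⁻¹ x⟩

section Expansive

variable {G : Type} [CommGroup G] {X : Type} [AddCommGroup X] [TopologicalSpace X]

theorem isExpansive_of_generators [IsTopologicalAddGroup X] [CompactSpace X] [T2Space X]
    (α : G →* (X ≃+ X)) (hc : ∀ g : G, Continuous (α g))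
    {k : ℕ} (a : Fin k → ContinuousAddMonoidHom X Torus)
    (hgen : ∀ b : ContinuousAddMonoidHom X Torus,
      ∃ f : Fin k → MonoidAlgebra ℤ G, b = ∑ j, dualSmul α hc (f j) (a j))
    (ha : ∀ j : Fin k, ¬ ∃ Φ : MonoidAlgebra ℤ G →+* ℂ,
      (∀ f : MonoidAlgebra ℤ G, dualSmul α hc f (a j) = 0 → Φ f = 0) ∧
      (∀ g : G, ‖Φ (MonoidAlgebra.of ℤ G g)‖ = 1)) :
    IsExpansive (fun g : G => ⇑(α g)) := by
  choose ε hε hzero using fun j => exists_pos_forall_norm_lt_imp_eq_zero α hc (a j) (ha j)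
  refine ⟨{x | ∀ j, ‖a j x‖ < ε j}, ?_, ?_⟩
  · refine eventually_all.2 fun j => ?_
    refine ((a j).continuous_toFun.norm.tendsto' 0 0 ?_).eventually (gt_mem_nhds (hε j))
    exact (congrArg norm (map_zero (a j))).trans norm_zero
  · ext x
    rw [mem_iInter_image_iff, Set.mem_singleton_iff]
    constructor
    · intro hx
      refine eq_zero_of_forall_torusHom_eq_zero fun ψ => ?_
      obtain ⟨f, rfl⟩ := hgen ψ
      let ev : ContinuousAddMonoidHom X Torus →+ Torus :=
        { toFun := fun χ => χ x
          map_zero' := rfl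
          map_add' := fun _ _ => rfl }
      change ev (∑ j, dualSmul α hc (f j) (a j)) = 0
      rw [map_sum]
      refine Finset.sum_eq_zero fun j _ => ?_
      refine (dualSmul_apply α hc (f j) (a j) x).trans (Finset.sum_eq_zero fun g _ => ?_)
      beta_reduce
      rw [hzero j x (fun g => hx g j) g, smul_zero]
    · rintro rfl g j
      rw [map_zero, map_zero, norm_zero]
      exact hε j

theorem exists_generators_of_isExpansive [IsTopologicalAddGroup X] [CompactSpace X] [T2Space X]
    (α : G →* (X ≃+ X)) (hc : ∀ g : G, Continuous (α g))
    (hα : IsExpansive (fun g : G => ⇑(α g))) :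
    ∃ (k : ℕ) (a : Fin k → ContinuousAddMonoidHom X Torus),
      (∀ b : ContinuousAddMonoidHom X Torus,
        ∃ f : Fin k → MonoidAlgebra ℤ G, b = ∑ j, dualSmul α hc (f j) (a j)) ∧
      (∀ j : Fin k, ¬ ∃ Φ : MonoidAlgebra ℤ G →+* ℂ,
        (∀ f : MonoidAlgebra ℤ G, dualSmul α hc f (a j) = 0 → Φ f = 0) ∧
        (∀ g : G, ‖Φ (MonoidAlgebra.of ℤ G g)‖ = 1)) := by
  obtain ⟨N, hN, hNα⟩ := hα
  obtain ⟨I, ε, hε, hI⟩ := exists_finset_norm_lt_subset hN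
  have hzero : ∀ x, (∀ g, ∀ χ ∈ I, ‖χ (α g x)‖ < ε) → x = 0 := fun x hx =>
    hNα.subset ((mem_iInter_image_iff α N x).2 fun g => hI _ (hx g))
  let := dualModule α hc
  have hsmul : ∀ (f : MonoidAlgebra ℤ G) (a : ContinuousAddMonoidHom X Torus),
      f • a = dualSmul α hc f a := fun f a => (dualSmul_eq_lift α hc f a).symm
  have hspan : Submodule.span (MonoidAlgebra ℤ G)
      (I : Set (ContinuousAddMonoidHom X Torus)) = ⊤ := by
    refine Submodule.eq_top_iff'.2 fun ψ => ?_
    refine mem_of_separating (Submodule.span (MonoidAlgebra ℤ G)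
      (I : Set (ContinuousAddMonoidHom X Torus))).toAddSubgroup (fun x hx => ?_) ψ
    refine hzero x fun g χ hχ => ?_
    have := hx (MonoidAlgebra.of ℤ G g • χ) (Submodule.smul_mem _ _ (Submodule.subset_span hχ))
    rw [hsmul] at this
    rw [← dualSmul_of_apply α hc, this, norm_zero]
    exact hε
  have hfin : Module.Finite (MonoidAlgebra ℤ G) (ContinuousAddMonoidHom X Torus) := ⟨⟨I, hspan⟩⟩
  obtain ⟨k, a, ha⟩ := Submodule.fg_iff_exists_fin_generating_family.1 hfin.fg_top
  refine ⟨k, a, fun b => ?_, fun j => ?_⟩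
  · obtain ⟨f, hf⟩ := (Submodule.mem_span_range_iff_exists_fun (MonoidAlgebra ℤ G)).1
      (ha.symm ▸ Submodule.mem_top : b ∈ Submodule.span (MonoidAlgebra ℤ G) (Set.range a))
    exact ⟨f, by simpa only [hsmul] using hf.symm⟩
  · rintro ⟨Φ, hΦ, hΦ1⟩
    obtain ⟨θ, hθ, b, hb⟩ := exists_semilinear_ne_zero (m := a j) Φ
      fun r hr => hΦ r ((hsmul r (a j)).symm.trans hr)
    let K : ℝ := 1 + ‖θ b‖ + ∑ χ ∈ I, ‖θ χ‖
    have hsum : 0 ≤ ∑ χ ∈ I, ‖θ χ‖ := Finset.sum_nonneg fun _ _ => norm_nonneg _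
    have hK : 0 < K := by positivity
    have hb0 : 0 < ‖θ b‖ := norm_pos_iff.2 hb
    obtain ⟨t, ht, htε, ht1⟩ : ∃ t : ℝ, 0 < t ∧ t * ‖θ b‖ * K < ε ∧ t * ‖θ b‖ * ‖θ b‖ < 1 := by
      have h1 : ∀ᶠ t : ℝ in 𝓝[>] 0, t * ‖θ b‖ * K < ε :=
        (((continuous_id.mul continuous_const).mul continuous_const).tendsto'
          (0 : ℝ) 0 (by simp)).mono_left nhdsWithin_le_nhds |>.eventually (gt_mem_nhds hε)
      have h2 : ∀ᶠ t : ℝ in 𝓝[>] 0, t * ‖θ b‖ * ‖θ b‖ < 1 :=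
        (((continuous_id.mul continuous_const).mul continuous_const).tendsto'
          (0 : ℝ) 0 (by simp)).mono_left nhdsWithin_le_nhds |>.eventually (gt_mem_nhds one_pos)
      obtain ⟨t, ⟨h3, h4⟩, h5⟩ := ((h1.and h2).and self_mem_nhdsWithin).exists
      exact ⟨t, h5, h3, h4⟩
    let c : ℂ := t * (starRingEnd ℂ) (θ b)
    have hcn : ‖c‖ = t * ‖θ b‖ := by
      rw [norm_mul, Complex.norm_real, Real.norm_of_nonneg ht.le, RCLike.norm_conj]
    let co : ℝ →+ Torus := QuotientAddGroup.mk' _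
    obtain ⟨x, hx⟩ := exists_forall_apply_eq
      (co.comp (Complex.reAddGroupHom.comp ((AddMonoidHom.mulLeft c).comp θ)))
    replace hx : ∀ χ : ContinuousAddMonoidHom X Torus, χ x = ((c * θ χ).re : Torus) := hx
    have hx0 : x = 0 := by
      refine hzero x fun g χ hχ => ?_
      rw [← dualSmul_of_apply α hc, hx, ← hsmul, hθ]
      calc ‖((c * (Φ (MonoidAlgebra.of ℤ G g) * θ χ)).re : Torus)‖
          ≤ ‖(c * (Φ (MonoidAlgebra.of ℤ G g) * θ χ)).re‖ := by
            rw [UnitAddCircle.norm_eq]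
            simpa using round_le (c * (Φ (MonoidAlgebra.of ℤ G g) * θ χ)).re 0
        _ ≤ ‖c * (Φ (MonoidAlgebra.of ℤ G g) * θ χ)‖ := Complex.abs_re_le_norm _
        _ = t * ‖θ b‖ * ‖θ χ‖ := by rw [norm_mul c, norm_mul (Φ _), hΦ1, one_mul, hcn]
        _ ≤ t * ‖θ b‖ * K := by
          have := Finset.single_le_sum (fun χ (_ : χ ∈ I) => norm_nonneg (θ χ)) hχ
          refine mul_le_mul_of_nonneg_left ?_ (by positivity)
          change _ ≤ 1 + ‖θ b‖ + ∑ χ ∈ I, ‖θ χ‖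
          linarith
        _ < ε := htε
    have hre : (c * θ b).re = t * ‖θ b‖ * ‖θ b‖ := by
      rw [mul_assoc (t : ℂ), ← Complex.normSq_eq_conj_mul_self, ← Complex.ofReal_mul,
        Complex.ofReal_re, Complex.normSq_eq_norm_sq]
      ring
    have h0 := hx b
    rw [hx0, map_zero, hre] at h0
    obtain ⟨n, hn⟩ := (AddCircle.coe_eq_zero_iff (1 : ℝ)).1 h0.symm
    have hpos : 0 < t * ‖θ b‖ * ‖θ b‖ := by positivity
    rw [← hn, zsmul_eq_mul, mul_one] at ht1 hpos
    have h1 : n < 1 := by exact_mod_cast ht1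
    have h2 : 0 < n := by exact_mod_cast hpos
    omega

end Expansive

end Helpers

theorem expansive_iff_finitely_generated_and_no_unit_circle_hom
    {G : Type} [CommGroup G] [Countable G]
    {X : Type} [AddCommGroup X] [TopologicalSpace X] [IsTopologicalAddGroup X]
    [CompactSpace X] [TopologicalSpace.MetrizableSpace X]
    (α : G →* (X ≃+ X)) (hc : ∀ g : G, Continuous (α g)) :
    IsExpansive (fun g : G => ⇑(α g)) ↔
      ∃ (k : ℕ) (a : Fin k → ContinuousAddMonoidHom X Torus),
        -- `a 0, …, a (k-1)` generate `M = X̂` as a `ℤ[G]`-module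
        (∀ b : ContinuousAddMonoidHom X Torus,
          ∃ f : Fin k → MonoidAlgebra ℤ G, b = ∑ j, dualSmul α hc (f j) (a j)) ∧
        -- and no annihilator `𝔞_j = Ann(a j)` admits a ring homomorphism
        -- `ℤ[G]/𝔞_j → ℂ` sending the image of `G` into the unit circle
        (∀ j : Fin k, ¬ ∃ Φ : MonoidAlgebra ℤ G →+* ℂ,
          (∀ f : MonoidAlgebra ℤ G, dualSmul α hc f (a j) = 0 → Φ f = 0) ∧
          (∀ g : G, ‖Φ (MonoidAlgebra.of ℤ G g)‖ = 1)) :=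
  ⟨exists_generators_of_isExpansive α hc,
    fun ⟨_, a, hgen, ha⟩ => isExpansive_of_generators α hc a hgen ha⟩
end
end

section
/- Let G be a countable abelian group, χ : G → ℂ^× a group homomorphism with |χ(g)| = 1 for all g ∈ G, and let W be a nontrivial closed subgroup of ℂ with χ(g)·W = W for every g ∈ G. Let β be the action of G on the Pontryagin dual Ŵ in which β_g is dual to multiplication by χ(g) on W. Then (Ŵ, β) is non-expansive: for every neighbourhood N of 0 in Ŵ one has ⋂_{g∈G} β_g(N) ≠ {0}. -/
open scoped Pointwise

noncomputable section

/-- The character `w ↦ Re (a * w) mod 1` of a subgroup `W` of `ℂ`. -/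
def reMulCharacter (W : AddSubgroup ℂ) (a : ℂ) : ContinuousAddMonoidHom W Torus where
  toFun w := (((a * (w : ℂ)).re : ℝ) : Torus)
  map_zero' := by simp
  map_add' v w := by simp [mul_add]
  continuous_toFun := (AddCircle.continuous_mk' 1).comp (by fun_prop)

theorem reMulCharacter_apply (W : AddSubgroup ℂ) (a : ℂ) (w : W) :
    reMulCharacter W a w = (((a * (w : ℂ)).re : ℝ) : Torus) := rfl

theorem reMulCharacter_zero (W : AddSubgroup ℂ) : reMulCharacter W 0 = 0 := by
  ext w
  simp [reMulCharacter_apply]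

theorem continuous_reMulCharacter (W : AddSubgroup ℂ) : Continuous (reMulCharacter W) :=
  ContinuousAddMonoidHom.continuous_of_continuous_uncurry _ <|
    (AddCircle.continuous_mk' 1).comp
      (show Continuous fun p : ℂ × W => (p.1 * (p.2 : ℂ)).re by fun_prop)

/-- A nontrivial subgroup of `ℂ` has nontrivial characters `reMulCharacter W a` with `a`
arbitrarily small. -/
theorem exists_norm_lt_reMulCharacter_ne_zero {W : AddSubgroup ℂ} (hW : W ≠ ⊥) {ε : ℝ}
    (hε : 0 < ε) : ∃ a : ℂ, ‖a‖ < ε ∧ reMulCharacter W a ≠ 0 := by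
  obtain ⟨w, hw0⟩ := AddSubgroup.ne_bot_iff_exists_ne_zero.1 hW
  rw [Ne, ← ZeroMemClass.coe_eq_zero] at hw0
  have hn : 0 < ‖(w : ℂ)‖ := norm_pos_iff.2 hw0
  obtain ⟨t, ht0, ht⟩ := exists_between
    (lt_min (div_pos hε hn) (div_pos one_pos (pow_pos hn 2)))
  obtain ⟨htε, ht1⟩ := lt_min_iff.1 ht
  rw [lt_div_iff₀ hn] at htε
  rw [lt_div_iff₀ (pow_pos hn 2)] at ht1
  refine ⟨t * (starRingEnd ℂ) (w : ℂ), by simpa [abs_of_pos ht0] using htε, fun h => ?_⟩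
  have hre : ((t * (starRingEnd ℂ) (w : ℂ)) * (w : ℂ)).re = t * ‖(w : ℂ)‖ ^ 2 := by
    rw [mul_assoc, Complex.conj_mul']
    norm_cast
  have hval : ((t * ‖(w : ℂ)‖ ^ 2 : ℝ) : Torus) = 0 := by
    rw [← hre, ← reMulCharacter_apply, h]
    rfl
  obtain ⟨n, hn'⟩ := (AddCircle.coe_eq_zero_iff (1 : ℝ)).1 hval
  rw [zsmul_eq_mul, mul_one] at hn'
  rw [← hn'] at ht1
  have hpos : (0 : ℝ) < n := hn' ▸ mul_pos ht0 (pow_pos hn 2)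
  have h1 : n < 1 := by exact_mod_cast ht1
  have h0 : 0 < n := by exact_mod_cast hpos
  omega

/-- let `χ : G → ℂ^×` be unitary (`|χ(g)| = 1`), `W ≠ {0}` a closed
subgroup of `ℂ` with `χ(g)·W = W` for all `g`, and let `β` be the `G`-action on the
Pontryagin dual `Ŵ` (continuous characters `W → 𝕋`, with the compact-open topology)
in which `β g` is dual to multiplication by `χ(g)` on `W`.  Then `(Ŵ, β)` is
non-expansive: every neighbourhood `N` of `0` has `⋂ g, β g (N) ≠ {0}`. -/
theorem unitary_dual_action_nonexpansive
    {G : Type} [CommGroup G] [Countable G]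
    (χ : G →* ℂˣ) (hχ : ∀ g : G, ‖(χ g : ℂ)‖ = 1)
    (W : AddSubgroup ℂ) (hWcl : IsClosed (W : Set ℂ)) (hWne : W ≠ ⊥)
    (hWinv : ∀ g : G, ((χ g : ℂ)) • (W : Set ℂ) = (W : Set ℂ))
    (β : G → ContinuousAddMonoidHom W Torus → ContinuousAddMonoidHom W Torus)
    (hβ : ∀ (g : G) (x : ContinuousAddMonoidHom W Torus) (w : W)
      (hm : (χ g : ℂ) * (w : ℂ) ∈ W), β g x w = x ⟨(χ g : ℂ) * (w : ℂ), hm⟩) :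
    ∀ N ∈ nhds (0 : ContinuousAddMonoidHom W Torus),
      (⋂ g : G, β g '' N) ≠ {0} := by
  intro N hN hN0
  have hnhds : reMulCharacter W ⁻¹' N ∈ nhds (0 : ℂ) :=
    (continuous_reMulCharacter W).continuousAt.preimage_mem_nhds
      (by rwa [reMulCharacter_zero])
  obtain ⟨ε, hε, hball⟩ := Metric.mem_nhds_iff.1 hnhds
  obtain ⟨a, ha, hne⟩ := exists_norm_lt_reMulCharacter_ne_zero hWne hε
  refine hne ((Set.ext_iff.1 hN0 _).1 (Set.mem_iInter.2 fun g => ?_))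
  refine ⟨reMulCharacter W (a * (χ g : ℂ)⁻¹), hball ?_, ?_⟩
  · simpa [hχ g] using ha
  · ext w
    have hm : (χ g : ℂ) * (w : ℂ) ∈ W := by
      have h : (χ g : ℂ) • (w : ℂ) ∈ (χ g : ℂ) • (W : Set ℂ) := Set.smul_mem_smul_set w.2
      rwa [hWinv g] at h
    rw [hβ g _ w hm, reMulCharacter_apply, reMulCharacter_apply, mul_assoc,
      inv_mul_cancel_left₀ (χ g).ne_zero]
end
end
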